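/- arXiv:1605.05854 — 3 statements merged into one kernel-verified Lean document; each statement's English description precedes it below -/
import Mathlib

section
/- Let d, N ≥ 1 and σ > 0. Let V₀ : ℝ^d → ℝ be smooth with e^{-V₀/σ} ∈ L¹(ℝ^d), V₀(x) → ∞ as |x| → ∞, and uniformly bounded Hessian, and let V₁ : ℝ^d × (ℝ^d)^N → ℝ be smooth, bounded (with all derivatives bounded), and ℤ^d-periodic in each of its last N arguments. Set V(x,y₁,…,y_N) = V₀(x) + V₁(x,y₁,…,y_N), for ε > 0 let π^ε be the probability density on ℝ^d proportional to e^{-V(x, x/ε, x/ε², …, x/ε^N)/σ}, and let π⁰ be the probability density proportional to Z(x) = ∫_{([0,1]^d)^N} e^{-V(x,y₁,…,y_N)/σ} dy₁⋯dy_N. Then for every measurable f : ℝ^d → ℝ with ∫_{ℝ^d} |f(x)|² e^{-V₀(x)/σ} dx < ∞, one has ∫_{ℝ^d} f(x) π^ε(x) dx → ∫_{ℝ^d} f(x) π⁰(x) dx as ε → 0⁺. -/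
open MeasureTheory Filter

lemma aux_translate {d : ℕ} (g : (Fin d → ℝ) → ℝ) (hg : Integrable g) :
    Tendsto (fun h : Fin d → ℝ => ∫ x, |g (x + h) - g x|) (nhds 0) (nhds 0) := by
  have hgm : ∀ h : Fin d → ℝ, MeasurePreserving (fun x => x + h) volume volume :=
    fun h => measurePreserving_add_right volume h
  have hg1 : MemLp g 1 := memLp_one_iff_integrable.2 hg
  let T : (Fin d → ℝ) → C(Fin d → ℝ, Fin d → ℝ) := fun h => ⟨fun x => x + h, by fun_prop⟩
  have hT : Continuous T := by
    apply ContinuousMap.continuous_of_continuous_uncurry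
    show Continuous (fun p : (Fin d → ℝ) × (Fin d → ℝ) => p.2 + p.1)
    fun_prop
  have hc := (continuous_const (y := hg1.toLp g)).compMeasurePreservingLp hT
    (fun h => hgm h) (by simp)
  have h2 := (hc.sub (continuous_const (y := hg1.toLp g))).norm.tendsto 0
  have key : ∀ h : Fin d → ℝ,
      ‖Lp.compMeasurePreserving (T h) (hgm h) (hg1.toLp g) - hg1.toLp g‖
      = ∫ x, |g (x + h) - g x| := by
    intro h
    rw [L1.norm_eq_integral_norm]
    apply integral_congr_ae
    have e : Lp.compMeasurePreserving (T h) (hgm h) (hg1.toLp g)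
        = (hg1.comp_measurePreserving (hgm h)).toLp _ := Lp.toLp_compMeasurePreserving hg1 (hgm h)
    rw [e, ← MemLp.toLp_sub]
    filter_upwards [MemLp.coeFn_toLp ((hg1.comp_measurePreserving (hgm h)).sub hg1)] with x hx
    rw [Real.norm_eq_abs, hx]
    rfl
  have h3 := h2.congr key
  have h4 : ∫ x, |g (x + 0) - g x| = 0 := by simp
  rw [← h4, ← key 0]
  exact h3

lemma aux_periodic {d : ℕ} (φ : (Fin d → ℝ) → ℝ)
    (hφ : ∀ (x : Fin d → ℝ) (k : Fin d → ℤ), φ (x + fun j => (k j : ℝ)) = φ x) (a : Fin d → ℝ) :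
    ∫ t in Set.Icc (0 : Fin d → ℝ) 1, φ (a + t) = ∫ t in Set.Icc (0 : Fin d → ℝ) 1, φ t := by
  have hae : (Set.pi Set.univ fun _ : Fin d ↦ Set.Ico (0 : ℝ) 1) =ᵐ[volume]
      Set.Icc (0 : Fin d → ℝ) 1 := Measure.univ_pi_Ico_ae_eq_Icc
  rw [← setIntegral_congr_set hae, ← setIntegral_congr_set hae,
    ← ZSpan.fundamentalDomain_pi_basisFun]
  set b := Pi.basisFun ℝ (Fin d)
  have hs := ZSpan.isAddFundamentalDomain' b (volume : Measure (Fin d → ℝ))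
  have hs' := hs.vadd_of_comm a
  have hinv : ∀ (g : (Submodule.span ℤ (Set.range b)).toAddSubgroup) (x : Fin d → ℝ), φ (g +ᵥ x) = φ x := by
    intro g x
    have := (b.mem_span_iff_repr_mem ℤ (g : Fin d → ℝ)).mp g.2
    choose k hk using this
    have h3 : g +ᵥ x = x + fun j => (k j : ℝ) := by
      ext j
      have := hk j
      simp [b] at this
      simp [AddSubgroup.vadd_def, this, add_comm]
    rw [h3, hφ]
  have hcount : Countable (Submodule.span ℤ (Set.range b)).toAddSubgroup :=
    inferInstanceAs (Countable (Submodule.span ℤ (Set.range b)))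
  rw [← hs'.setIntegral_eq hs hinv]
  exact ((measurePreserving_add_left volume a).setIntegral_image_emb
    (measurableEmbedding_addLeft a) φ _).symm

instance aux_prob (d : ℕ) :
    IsProbabilityMeasure ((volume : Measure (Fin d → ℝ)).restrict (Set.Icc 0 1)) := by
  constructor
  simp [Real.volume_Icc_pi]

lemma aux_cont {d N : ℕ} (F : (Fin d → ℝ) → (Fin N → Fin d → ℝ) → ℝ) (L : ℝ) (hL : 0 ≤ L)
    (hF : ∀ x x' y y', |F x y - F x' y'| ≤ L * (‖x - x'‖ + ‖y - y'‖)) :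
    Continuous (fun p : (Fin d → ℝ) × (Fin N → Fin d → ℝ) => F p.1 p.2) := by
  apply (LipschitzWith.of_dist_le_mul (K := (2 * L).toNNReal) _).continuous
  intro p q
  rw [Real.dist_eq, Real.coe_toNNReal _ (by positivity), dist_eq_norm]
  refine (hF _ _ _ _).trans ?_
  have h1 := norm_fst_le (p - q)
  have h2 := norm_snd_le (p - q)
  simp only [Prod.fst_sub, Prod.snd_sub] at h1 h2
  nlinarith

lemma aux_snoc {d N : ℕ} (y y' : Fin N → Fin d → ℝ) (t : Fin d → ℝ) :
    ‖(Fin.snoc y t : Fin (N+1) → Fin d → ℝ) - Fin.snoc (α := fun _ => Fin d → ℝ) y' t‖ ≤ ‖y - y'‖ := by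
  rw [pi_norm_le_iff_of_nonneg (norm_nonneg _)]
  intro i
  induction i using Fin.lastCases with
  | last => simp
  | cast i => simpa using norm_le_pi_norm (y - y') i

lemma aux_fubini {d N : ℕ} (G : (Fin (N+1) → Fin d → ℝ) → ℝ) (hG : Continuous G)
    (C : ℝ) (hC : ∀ y, |G y| ≤ C) :
    ∫ y, G y ∂(Measure.pi fun _ : Fin (N+1) => (volume : Measure (Fin d → ℝ)).restrict (Set.Icc 0 1))
    = ∫ y, (∫ t in Set.Icc (0 : Fin d → ℝ) 1, G (Fin.snoc y t))
      ∂(Measure.pi fun _ : Fin N => (volume : Measure (Fin d → ℝ)).restrict (Set.Icc 0 1)) := by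
  have h := (measurePreserving_piFinSuccAbove
    (fun _ : Fin (N+1) => (volume : Measure (Fin d → ℝ)).restrict (Set.Icc 0 1)) (Fin.last N)).symm
  rw [← h.integral_comp']
  rw [integral_prod_symm]
  · simp
    rfl
  · apply Integrable.of_bound (C := C)
    · apply Measurable.aestronglyMeasurable
      exact hG.measurable.comp (MeasurableEquiv.measurable _)
    · exact ae_of_all _ fun p => hC _

lemma aux_step {d N : ℕ} (g : (Fin d → ℝ) → ℝ) (hg : Integrable g)
    (F : (Fin d → ℝ) → (Fin (N+1) → Fin d → ℝ) → ℝ) (C L : ℝ) (hL : 0 ≤ L)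
    (hFb : ∀ x y, |F x y| ≤ C)
    (hF : ∀ x x' y y', |F x y - F x' y'| ≤ L * (‖x - x'‖ + ‖y - y'‖))
    (hper : ∀ (x : Fin d → ℝ) (y : Fin (N+1) → Fin d → ℝ) (i : Fin (N+1)) (k : Fin d → ℤ),
      F x (Function.update y i (y i + fun j => (k j : ℝ))) = F x y) :
    Tendsto (fun ε : ℝ => (∫ x, g x * F x fun i => (ε ^ ((i : ℕ) + 1))⁻¹ • x) -
      ∫ x, g x * ∫ t in Set.Icc (0 : Fin d → ℝ) 1,
        F x (Fin.snoc (fun i : Fin N => (ε ^ ((i : ℕ) + 1))⁻¹ • x) t))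
      (nhdsWithin 0 (Set.Ioi 0)) (nhds 0) := by
  have hC : 0 ≤ C := (abs_nonneg _).trans (hFb 0 0)
  have hcont := aux_cont F L hL hF
  have hcomp : ∀ {X : Type} [TopologicalSpace X] (u : X → Fin d → ℝ)
      (v : X → Fin (N+1) → Fin d → ℝ), Continuous u → Continuous v →
      Continuous fun x => F (u x) (v x) := fun u v hu hv => hcont.comp (hu.prodMk hv)
  rw [Metric.tendsto_nhds]
  intro η hη
  have htr := Metric.tendsto_nhds.1 (aux_translate g hg) (η / (2 * (C + 1))) (by positivity)
  obtain ⟨δ, hδ, hδ'⟩ := Metric.eventually_nhds_iff.1 htr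
  set I := ∫ x, |g x| with hI
  have hI0 : 0 ≤ I := integral_nonneg fun x => abs_nonneg _
  have e1 : ∀ᶠ ε : ℝ in nhdsWithin 0 (Set.Ioi 0), ε < min (min 1 δ) (η / (4 * (L + 1) * (I + 1))) :=
    nhdsWithin_le_nhds (gt_mem_nhds (by positivity))
  filter_upwards [e1, self_mem_nhdsWithin] with ε hε hε0
  have hε0 : 0 < ε := hε0
  simp only [lt_min_iff] at hε
  obtain ⟨⟨hε1, hεδ⟩, hεη⟩ := hε
  -- pointwise data
  let A : (Fin d → ℝ) → (Fin (N+1) → Fin d → ℝ) := fun x i => (ε ^ ((i : ℕ) + 1))⁻¹ • x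
  let B : (Fin d → ℝ) → (Fin d → ℝ) → (Fin (N+1) → Fin d → ℝ) := fun x t =>
    Fin.snoc (fun i : Fin N => (ε ^ ((i : ℕ) + 1))⁻¹ • x) ((ε ^ (N + 1))⁻¹ • x + t)
  have hA : Continuous A := by fun_prop
  have hB : Continuous fun p : (Fin d → ℝ) × (Fin d → ℝ) => B p.1 p.2 := by
    refine continuous_pi fun i => ?_
    induction i using Fin.lastCases with
    | last => simp only [B, Fin.snoc_last]; fun_prop
    | cast i => simp only [B, Fin.snoc_castSucc]; fun_prop
  have hgA : Integrable fun x => g x * F x (A x) :=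
    hg.mul_bdd (c := C) (hcomp _ _ continuous_id hA).aestronglyMeasurable
      (ae_of_all _ fun x => hFb _ _)
  have hgB : ∀ t, Integrable fun x => g x * F x (B x t) := fun t =>
    hg.mul_bdd (c := C) (hcomp _ _ continuous_id
      (hB.comp (continuous_id.prodMk continuous_const))).aestronglyMeasurable
      (ae_of_all _ fun x => hFb _ _)
  set μ := (volume : Measure (Fin d → ℝ)).restrict (Set.Icc 0 1) with hμ
  have hprod : Integrable (fun p : (Fin d → ℝ) × (Fin d → ℝ) => g p.1 * F p.1 (B p.1 p.2))
      (volume.prod μ) :=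
    (hg.comp_fst μ).mul_bdd (c := C) (hcomp _ _ continuous_fst hB).aestronglyMeasurable
      (ae_of_all _ fun x => hFb _ _)
  have hsecond : (∫ x, g x * ∫ t in Set.Icc (0 : Fin d → ℝ) 1,
        F x (Fin.snoc (fun i : Fin N => (ε ^ ((i : ℕ) + 1))⁻¹ • x) t))
      = ∫ t, (∫ x, g x * F x (B x t)) ∂μ := by
    rw [← integral_integral_swap (f := fun x t => g x * F x (B x t)) hprod]
    congr 1
    ext x
    rw [integral_const_mul]
    congr 1
    rw [hμ]
    refine (aux_periodic (fun t => F x (Fin.snoc (fun i : Fin N => (ε ^ ((i : ℕ) + 1))⁻¹ • x) t))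
      ?_ _).symm
    intro t k
    have := hper x (Fin.snoc (fun i : Fin N => (ε ^ ((i : ℕ) + 1))⁻¹ • x) t) (Fin.last N) k
    rwa [Fin.snoc_last, Fin.update_snoc_last] at this
  have hfirst : (∫ x, g x * F x (A x)) = ∫ t, (∫ x, g x * F x (A x)) ∂μ := by
    simp
  have hptw : ∀ t ∈ Set.Icc (0 : Fin d → ℝ) 1,
      ‖(∫ x, g x * F x (A x)) - ∫ x, g x * F x (B x t)‖
        ≤ C * (η / (2 * (C + 1))) + 2 * L * ε * I := by
    intro t ht
    have ht1 : ‖t‖ ≤ 1 := by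
      rw [pi_norm_le_iff_of_nonneg zero_le_one]
      intro i
      rw [Real.norm_eq_abs, abs_le]
      exact ⟨by linarith [ht.1 i, show (0 : Fin d → ℝ) i = 0 from rfl], ht.2 i⟩
    set h := ε ^ (N + 1) • t with hh
    have hpow : ∀ n : ℕ, ‖ε ^ (n + 1) • t‖ ≤ ε := by
      intro n
      rw [norm_smul, Real.norm_eq_abs, abs_of_pos (by positivity)]
      have : ε ^ (n + 1) ≤ ε := by
        rw [pow_succ]
        have := pow_le_one₀ (n := n) hε0.le hε1.le
        nlinarith
      have h0 := norm_nonneg t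
      nlinarith [pow_pos hε0 (n + 1)]
    have hhn : ‖h‖ ≤ ε := hpow N
    have hAB : ∀ x, ‖A (x + h) - B x t‖ ≤ ε := by
      intro x
      rw [pi_norm_le_iff_of_nonneg hε0.le]
      intro i
      induction i using Fin.lastCases with
      | last =>
        have : A (x + h) (Fin.last N) - B x t (Fin.last N) = 0 := by
          simp only [A, B, Fin.snoc_last, Fin.val_last, hh, smul_add, smul_smul]
          rw [inv_mul_cancel₀ (by positivity)]
          simp
        rw [Pi.sub_apply, this, norm_zero]
        exact hε0.le
      | cast i =>
        have : A (x + h) i.castSucc - B x t i.castSucc = ε ^ ((N - 1 - i) + 1) • t := by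
          simp only [A, B, Fin.snoc_castSucc, Fin.val_castSucc, hh, smul_add, smul_smul,
            add_sub_cancel_left]
          congr 1
          have e : N + 1 = (i + 1) + ((N - 1 - i) + 1) := by have := i.2; omega
          rw [e, pow_add ε (i + 1 : ℕ), inv_mul_cancel_left₀ (by positivity)]
        rw [Pi.sub_apply, this]
        exact hpow _
    have htrans : (∫ x, g x * F x (A x)) = ∫ x, g (x + h) * F (x + h) (A (x + h)) :=
      (integral_add_right_eq_self (fun x => g x * F x (A x)) h).symm
    have hgh : Integrable fun x => g (x + h) := hg.comp_add_right h
    rw [htrans, ← integral_sub (hgA.comp_add_right h) (hgB t)]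
    have hb : ∀ x, ‖g (x + h) * F (x + h) (A (x + h)) - g x * F x (B x t)‖
        ≤ C * |g (x + h) - g x| + 2 * L * ε * |g x| := by
      intro x
      rw [Real.norm_eq_abs]
      have e : g (x + h) * F (x + h) (A (x + h)) - g x * F x (B x t)
        = F (x + h) (A (x + h)) * (g (x + h) - g x)
          + (F (x + h) (A (x + h)) - F x (B x t)) * g x := by ring
      rw [e]
      refine (abs_add_le _ _).trans ?_
      rw [abs_mul, abs_mul]
      have h1 := hFb (x + h) (A (x + h))
      have h2 : |F (x + h) (A (x + h)) - F x (B x t)| ≤ 2 * L * ε := by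
        refine (hF _ _ _ _).trans ?_
        have := hAB x
        rw [add_sub_cancel_left]
        nlinarith
      gcongr
    refine (norm_integral_le_of_norm_le (((hgh.sub hg).abs.const_mul C).add
      (hg.abs.const_mul (2 * L * ε))) (ae_of_all _ hb)).trans ?_
    have hi : Integrable fun x => |g (x + h) - g x| := (hgh.sub hg).abs
    have e2 : ∫ x, (C * |g (x + h) - g x| + 2 * L * ε * |g x|)
        = C * (∫ x, |g (x + h) - g x|) + 2 * L * ε * I := by
      rw [integral_add (hi.const_mul C) (hg.abs.const_mul (2 * L * ε)),
        integral_const_mul, integral_const_mul]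
    have e3 := hδ' (y := h) (by rw [dist_zero_right]; linarith)
    rw [Real.dist_eq, sub_zero] at e3
    have e4 := (le_abs_self _).trans e3.le
    refine e2.le.trans ?_
    gcongr
  rw [dist_zero_right]
  change ‖(∫ x, g x * F x (A x)) - _‖ < η
  rw [hsecond, hfirst, ← integral_sub (integrable_const _) hprod.integral_prod_right]
  have hle := norm_integral_le_of_norm_le_const (μ := μ)
    (f := fun t => (∫ x, g x * F x (A x)) - ∫ x, g x * F x (B x t))
    (ae_restrict_of_forall_mem measurableSet_Icc hptw)
  refine hle.trans_lt ?_
  simp only [probReal_univ, mul_one]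
  have b1 : C * (η / (2 * (C + 1))) < η / 2 := by
    rw [mul_div_assoc', div_lt_div_iff₀ (by positivity) (by positivity)]
    nlinarith
  have b2 : 2 * L * ε * I ≤ η / 2 := by
    rw [lt_div_iff₀ (by positivity)] at hεη
    have : L * I ≤ (L + 1) * (I + 1) := by nlinarith
    nlinarith
  linarith

lemma aux_core {d : ℕ} (g : (Fin d → ℝ) → ℝ) (hg : Integrable g) (C L : ℝ) (hL : 0 ≤ L) :
    ∀ (N : ℕ) (F : (Fin d → ℝ) → (Fin N → Fin d → ℝ) → ℝ) 
    (_ : ∀ x y, |F x y| ≤ C)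
    (_ : ∀ x x' y y', |F x y - F x' y'| ≤ L * (‖x - x'‖ + ‖y - y'‖))
    (_ : ∀ (x : Fin d → ℝ) (y : Fin N → Fin d → ℝ) (i : Fin N) (k : Fin d → ℤ),
      F x (Function.update y i (y i + fun j => (k j : ℝ))) = F x y),
    Tendsto (fun ε : ℝ => ∫ x, g x * F x fun i => (ε ^ ((i : ℕ) + 1))⁻¹ • x)
      (nhdsWithin 0 (Set.Ioi 0)) (nhds (∫ x, g x * ∫ y, F x y ∂(Measure.pi
        fun _ : Fin N => (volume : Measure (Fin d → ℝ)).restrict (Set.Icc 0 1)))) := by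
  intro N
  induction N with
  | zero =>
    intro F _ _ _
    have : ∀ x, ∫ y, F x y ∂(Measure.pi
        fun _ : Fin 0 => (volume : Measure (Fin d → ℝ)).restrict (Set.Icc 0 1)) = F x default := by
      intro x
      rw [Measure.pi_of_empty, integral_dirac]
      congr 1
      exact Subsingleton.elim _ _
    simp_rw [this]
    refine tendsto_const_nhds.congr fun ε => ?_
    congr 1
    ext x
    congr 2
    exact Subsingleton.elim _ _
  | succ N ih =>
    intro F hFb hF hper
    have hcont := aux_cont F L hL hF
    have hsn : ∀ y : Fin N → Fin d → ℝ, Continuous fun t : Fin d → ℝ =>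
        (Fin.snoc y t : Fin (N+1) → Fin d → ℝ) := by
      intro y
      refine continuous_pi fun i => ?_
      induction i using Fin.lastCases with
      | last => simpa using continuous_id'
      | cast i => simpa using continuous_const
    have hint : ∀ x (y : Fin N → Fin d → ℝ), Integrable (fun t => F x (Fin.snoc y t))
        ((volume : Measure (Fin d → ℝ)).restrict (Set.Icc 0 1)) := fun x y =>
      Integrable.of_bound (C := C)
        (hcont.comp (continuous_const.prodMk (hsn y))).aestronglyMeasurable
        (ae_of_all _ fun t => hFb _ _)
    have h1 := ih (fun x y => ∫ t in Set.Icc (0 : Fin d → ℝ) 1, F x (Fin.snoc y t)) ?_ ?_ ?_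
    · have h2 := (aux_step g hg F C L hL hFb hF hper).add h1
      simp only [sub_add_cancel, zero_add] at h2
      convert h2 using 2
      congr 1
      ext x
      congr 1
      exact aux_fubini (F x) (hcont.comp (continuous_const.prodMk continuous_id)) C (hFb x)
    · intro x y
      have := norm_integral_le_of_norm_le_const
        (μ := (volume : Measure (Fin d → ℝ)).restrict (Set.Icc 0 1))
        (f := fun t => F x (Fin.snoc y t)) (ae_of_all _ fun t => hFb _ _)
      simpa using this
    · intro x x' y y'
      rw [← integral_sub (hint x y) (hint x' y')]
      have := norm_integral_le_of_norm_le_const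
        (μ := (volume : Measure (Fin d → ℝ)).restrict (Set.Icc 0 1))
        (f := fun t => F x (Fin.snoc y t) - F x' (Fin.snoc y' t))
        (C := L * (‖x - x'‖ + ‖y - y'‖)) (ae_of_all _ fun t => by
          refine (hF _ _ _ _).trans ?_
          have := aux_snoc y y' t
          gcongr)
      simpa using this
    · intro x y i k
      congr 1
      ext t
      have := hper x (Fin.snoc y t) i.castSucc k
      rw [← this]
      congr 1
      rw [Fin.snoc_update]
      simp

lemma aux_exp (M a b : ℝ) (ha : a ≤ M) (hb : b ≤ M) :
    |Real.exp a - Real.exp b| ≤ Real.exp M * |a - b| := by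
  wlog h : b ≤ a generalizing a b
  · rw [abs_sub_comm, abs_sub_comm a b]
    exact this b a hb ha (le_of_not_ge h)
  rw [abs_of_nonneg (sub_nonneg.2 (Real.exp_le_exp.2 h)), abs_of_nonneg (sub_nonneg.2 h)]
  have h1 := Real.add_one_le_exp (b - a)
  have h2 : Real.exp b = Real.exp a * Real.exp (b - a) := by rw [← Real.exp_add]; ring_nf
  have h3 : Real.exp a ≤ Real.exp M := Real.exp_le_exp.2 ha
  have h4 := Real.exp_pos a
  nlinarith

/-- **Proposition 2.5.** Weak convergence of the multiscale Gibbs measures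
`π^ε ∝ e^{-V(x,x/ε,…,x/ε^N)/σ}` to the homogenized Gibbs measure `π⁰ ∝ Z(x)`,
tested against any `f` with `∫ |f|² e^{-V₀/σ} < ∞`. -/
theorem stmt6 (d N : ℕ) (hd : 1 ≤ d) (hN : 1 ≤ N) (σ : ℝ) (hσ : 0 < σ)
    (V₀ : (Fin d → ℝ) → ℝ) (hV₀smooth : ContDiff ℝ (⊤ : ℕ∞) V₀)
    (hV₀int : Integrable (fun x => Real.exp (-V₀ x / σ)))
    (hV₀conf : Tendsto V₀ (cocompact (Fin d → ℝ)) atTop)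
    (hV₀hess : ∃ C : ℝ, ∀ x, ‖iteratedFDeriv ℝ 2 V₀ x‖ ≤ C)
    (V₁ : (Fin d → ℝ) → (Fin N → Fin d → ℝ) → ℝ)
    (hV₁smooth : ContDiff ℝ (⊤ : ℕ∞) (fun p : (Fin d → ℝ) × (Fin N → Fin d → ℝ) => V₁ p.1 p.2))
    (hV₁der : ∀ n : ℕ, ∃ C : ℝ, ∀ p : (Fin d → ℝ) × (Fin N → Fin d → ℝ),
      ‖iteratedFDeriv ℝ n (fun q : (Fin d → ℝ) × (Fin N → Fin d → ℝ) => V₁ q.1 q.2) p‖ ≤ C)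
    (hV₁bdd : ∃ C : ℝ, ∀ x y, |V₁ x y| ≤ C)
    (hV₁per : ∀ (x : Fin d → ℝ) (y : Fin N → Fin d → ℝ) (i : Fin N) (k : Fin d → ℤ),
      V₁ x (Function.update y i (y i + fun j => (k j : ℝ))) = V₁ x y)
    (πeps : ℝ → (Fin d → ℝ) → ℝ)
    (hπeps : ∀ ε x, πeps ε x =
      Real.exp (-(V₀ x + V₁ x fun i => (ε ^ ((i : ℕ) + 1))⁻¹ • x) / σ) /
        ∫ z, Real.exp (-(V₀ z + V₁ z fun i => (ε ^ ((i : ℕ) + 1))⁻¹ • z) / σ))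
    (Z : (Fin d → ℝ) → ℝ)
    (hZ : ∀ x, Z x = ∫ y in Set.Icc (0 : Fin N → Fin d → ℝ) 1,
      Real.exp (-(V₀ x + V₁ x y) / σ))
    (π0 : (Fin d → ℝ) → ℝ) (hπ0 : ∀ x, π0 x = Z x / ∫ z, Z z) :
    ∀ f : (Fin d → ℝ) → ℝ, Measurable f →
      Integrable (fun x => f x ^ 2 * Real.exp (-V₀ x / σ)) →
      Tendsto (fun ε : ℝ => ∫ x, f x * πeps ε x) (nhdsWithin 0 (Set.Ioi 0))
        (nhds (∫ x, f x * π0 x)) := by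
  intro f hf hf2
  obtain ⟨C, hC⟩ := hV₁bdd
  obtain ⟨K, hK⟩ := hV₁der 1
  have hK0 : 0 ≤ K := (norm_nonneg _).trans (hK 0)
  have hlip : ∀ x x' y y', |V₁ x y - V₁ x' y'| ≤ K * (‖x - x'‖ + ‖y - y'‖) := by
    intro x x' y y'
    have h := Convex.norm_image_sub_le_of_norm_fderiv_le (𝕜 := ℝ) (s := Set.univ) (C := K)
      (f := fun p : (Fin d → ℝ) × (Fin N → Fin d → ℝ) => V₁ p.1 p.2)
      (fun p _ => (hV₁smooth.differentiable (by simp)).differentiableAt)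
      (fun p _ => by rw [← norm_iteratedFDeriv_one]; exact hK p)
      convex_univ (Set.mem_univ (x', y')) (Set.mem_univ (x, y))
    refine h.trans ?_
    gcongr
    rw [Prod.mk_sub_mk, Prod.norm_mk]
    exact max_le_add_of_nonneg (norm_nonneg _) (norm_nonneg _)
  set F : (Fin d → ℝ) → (Fin N → Fin d → ℝ) → ℝ := fun x y => Real.exp (-V₁ x y / σ) with hFdef
  have hub : ∀ x y, -V₁ x y / σ ≤ C / σ := fun x y => by
    gcongr
    linarith [(abs_le.1 (hC x y)).1]
  have hlb : ∀ x y, -C / σ ≤ -V₁ x y / σ := fun x y => by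
    gcongr
    linarith [(abs_le.1 (hC x y)).2]
  have hFb : ∀ x y, |F x y| ≤ Real.exp (C / σ) := fun x y => by
    rw [abs_of_pos (Real.exp_pos _)]
    exact Real.exp_le_exp.2 (hub x y)
  have hFL : ∀ x x' y y', |F x y - F x' y'| ≤
      (Real.exp (C / σ) * (K / σ)) * (‖x - x'‖ + ‖y - y'‖) := by
    intro x x' y y'
    refine (aux_exp _ _ _ (hub x y) (hub x' y')).trans ?_
    rw [mul_assoc]
    gcongr
    have e : -V₁ x y / σ - -V₁ x' y' / σ = -(V₁ x y - V₁ x' y') / σ := by ring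
    rw [e, abs_div, abs_neg, abs_of_pos hσ, div_mul_eq_mul_div]
    gcongr
    exact hlip _ _ _ _
  have hL0 : 0 ≤ Real.exp (C / σ) * (K / σ) := by positivity
  have hper : ∀ (x : Fin d → ℝ) (y : Fin N → Fin d → ℝ) (i : Fin N) (k : Fin d → ℤ),
      F x (Function.update y i (y i + fun j => (k j : ℝ))) = F x y := fun x y i k => by
    simp only [hFdef, hV₁per]
  have hcont := aux_cont F _ hL0 hFL
  set g₀ : (Fin d → ℝ) → ℝ := fun x => Real.exp (-V₀ x / σ) with hg₀
  have hsplit : ∀ x y, Real.exp (-(V₀ x + V₁ x y) / σ) = g₀ x * F x y := fun x y => by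
    simp only [hg₀, hFdef]
    rw [← Real.exp_add]
    ring_nf
  have hfg : Integrable fun x => f x * g₀ x := by
    refine Integrable.mono' (hV₀int.add hf2) ?_ (ae_of_all _ fun x => ?_)
    · exact hf.aestronglyMeasurable.mul hV₀int.aestronglyMeasurable
    · rw [norm_mul, Real.norm_eq_abs, Real.norm_eq_abs, abs_of_pos (Real.exp_pos (-V₀ x / σ))]
      show |f x| * g₀ x ≤ g₀ x + f x ^ 2 * g₀ x
      have : 0 < g₀ x := Real.exp_pos _
      have h2 : |f x| ≤ 1 + f x ^ 2 := by
        rw [← sq_abs]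
        nlinarith [sq_nonneg (|f x| - 1), abs_nonneg (f x)]
      nlinarith
  have hnum := aux_core (fun x => f x * g₀ x) hfg _ _ hL0 N F hFb hFL hper
  have hden := aux_core g₀ hV₀int _ _ hL0 N F hFb hFL hper
  have hmeas : (volume : Measure (Fin N → Fin d → ℝ)).restrict (Set.Icc 0 1)
      = Measure.pi fun _ : Fin N => (volume : Measure (Fin d → ℝ)).restrict (Set.Icc 0 1) := by
    rw [← Measure.restrict_pi_pi, Set.pi_univ_Icc]
    rfl
  have hZ' : ∀ x, Z x = g₀ x * ∫ y, F x y ∂(Measure.pi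
        fun _ : Fin N => (volume : Measure (Fin d → ℝ)).restrict (Set.Icc 0 1)) := by
    intro x
    rw [hZ, hmeas]
    simp_rw [hsplit]
    rw [integral_const_mul]
  have hpos : 0 < ∫ z, Z z := by
    have h0 : 0 < ∫ x, g₀ x := integral_exp_pos hV₀int
    refine lt_of_lt_of_le (mul_pos h0 (Real.exp_pos (-C / σ))) ?_
    simp_rw [hZ']
    refine ge_of_tendsto hden (Eventually.of_forall fun ε => ?_)
    rw [← integral_mul_const]
    refine integral_mono (hV₀int.mul_const _) (hV₀int.mul_bdd (c := Real.exp (C / σ))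
      (hcont.comp (continuous_id.prodMk (by fun_prop : Continuous fun (x : Fin d → ℝ)
        (i : Fin N) => (ε ^ ((i : ℕ) + 1))⁻¹ • x))).aestronglyMeasurable
      (ae_of_all _ fun x => hFb _ _)) fun x => ?_
    exact mul_le_mul_of_nonneg_left (Real.exp_le_exp.2 (hlb _ _)) (Real.exp_pos _).le
  simp_rw [← hZ'] at hden
  have hfin := hnum.div hden hpos.ne'
  have e1 : ∫ x, f x * π0 x = (∫ x, f x * g₀ x * ∫ y, F x y ∂(Measure.pi
        fun _ : Fin N => (volume : Measure (Fin d → ℝ)).restrict (Set.Icc 0 1))) / ∫ z, Z z := by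
    rw [← integral_div]
    congr 1
    ext x
    rw [hπ0, hZ']
    ring
  rw [e1]
  refine hfin.congr fun ε => ?_
  rw [Pi.div_apply, ← integral_div]
  congr 1
  ext x
  rw [hπeps]
  simp_rw [hsplit]
  ring
end

section
/- Let d, N ≥ 1 and σ > 0. Let V₀ : ℝ^d → ℝ be smooth with e^{-V₀/σ} ∈ L¹(ℝ^d) and V₀(x) → ∞ as |x| → ∞, and let V₁ : ℝ^d × (ℝ^d)^N → ℝ be smooth, bounded with all derivatives bounded, and ℤ^d-periodic in each of its last N arguments. Set V(x,y₁,…,y_N) = V₀(x) + V₁(x,y₁,…,y_N). Then the normalization constants converge: ∫_{ℝ^d} e^{-V(x, x/ε, x/ε², …, x/ε^N)/σ} dx → ∫_{ℝ^d} ∫_{([0,1]^d)^N} e^{-V(x, y₁, …, y_N)/σ} dy₁⋯dy_N dx as ε → 0⁺. -/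
open MeasureTheory Filter

section helpers

open scoped Pointwise

/-- Integrals of periodic functions over shifted unit cells agree. -/
lemma periodic_shift (d : ℕ) (h : (Fin d → ℝ) → ℝ)
    (hp : ∀ (x : Fin d → ℝ) (k : Fin d → ℤ), h (x + fun j => (k j : ℝ)) = h x) (a : Fin d → ℝ) :
    ∫ t in Set.Icc (0 : Fin d → ℝ) 1, h (a + t) = ∫ t in Set.Icc (0 : Fin d → ℝ) 1, h t := by
  have hD := ZSpan.isAddFundamentalDomain' (Pi.basisFun ℝ (Fin d)) (volume : Measure (Fin d → ℝ))
  have hD2 := hD.vadd_of_comm a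
  have hae : ZSpan.fundamentalDomain (Pi.basisFun ℝ (Fin d)) =ᵐ[volume]
      Set.Icc (0 : Fin d → ℝ) 1 := by
    rw [ZSpan.fundamentalDomain_pi_basisFun]
    exact Measure.univ_pi_Ico_ae_eq_Icc (f := (0 : Fin d → ℝ)) (g := 1)
      (μ := fun _ : Fin d => (volume : Measure ℝ))
  have hinv : ∀ (g : (Submodule.span ℤ (Set.range (Pi.basisFun ℝ (Fin d)))).toAddSubgroup) (x : Fin d → ℝ),
      h (g +ᵥ x) = h x := by
    intro g x
    have hg := (Module.Basis.mem_span_iff_repr_mem ℤ (Pi.basisFun ℝ (Fin d)) (g : Fin d → ℝ)).1 g.2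
    choose k hk using hg
    have : (g +ᵥ x : Fin d → ℝ) = x + fun j => (k j : ℝ) := by
      ext j
      have := hk j
      simp at this
      rw [AddSubgroup.vadd_def]
      simp [this, add_comm]
    rw [this, hp]
  have hcount : Countable (Submodule.span ℤ (Set.range (Pi.basisFun ℝ (Fin d)))).toAddSubgroup :=
    inferInstanceAs (Countable (Submodule.span ℤ (Set.range (Pi.basisFun ℝ (Fin d)))))
  have key := hD.setIntegral_eq hD2 hinv
  rw [← setIntegral_congr_set hae, ← setIntegral_congr_set hae, key]
  have e1 : a +ᵥ ZSpan.fundamentalDomain (Pi.basisFun ℝ (Fin d)) =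
      (fun t => a + t) '' ZSpan.fundamentalDomain (Pi.basisFun ℝ (Fin d)) := rfl
  rw [e1]
  exact ((measurePreserving_add_left volume a).setIntegral_image_emb
    (MeasurableEquiv.addLeft a).measurableEmbedding h _).symm

/-- Fubini: splitting off the last variable. -/
lemma split_last (d N : ℕ) (h : (Fin (N + 1) → Fin d → ℝ) → ℝ) (hc : Continuous h) :
    ∫ y in Set.Icc (0 : Fin (N + 1) → Fin d → ℝ) 1, h y =
      ∫ y in Set.Icc (0 : Fin N → Fin d → ℝ) 1, ∫ t in Set.Icc (0 : Fin d → ℝ) 1,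
        h (Fin.snoc (α := fun _ => Fin d → ℝ) y t) := by
  have hmp := (volume_preserving_piFinSuccAbove (fun _ : Fin (N + 1) => Fin d → ℝ)
    (Fin.last N)).symm
  have h1 := hmp.setIntegral_preimage_emb (MeasurableEquiv.measurableEmbedding _) h
    (Set.Icc (0 : Fin (N + 1) → Fin d → ℝ) 1)
  rw [← h1]
  have hs : ∀ p : (Fin d → ℝ) × (Fin N → Fin d → ℝ),
      (MeasurableEquiv.piFinSuccAbove (fun _ : Fin (N + 1) => Fin d → ℝ) (Fin.last N)).symm p
        = Fin.snoc (α := fun _ => Fin d → ℝ) p.2 p.1 := by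
    intro p
    rw [← Fin.insertNth_last']
    rfl
  have hset : (MeasurableEquiv.piFinSuccAbove (fun _ : Fin (N + 1) => Fin d → ℝ)
      (Fin.last N)).symm ⁻¹' (Set.Icc (0 : Fin (N + 1) → Fin d → ℝ) 1) =
      Set.Icc (0 : Fin d → ℝ) 1 ×ˢ Set.Icc (0 : Fin N → Fin d → ℝ) 1 := by
    ext p
    rw [Set.mem_preimage, hs]
    simp only [Set.mem_Icc, Set.mem_prod, Pi.le_def (x := (0 : Fin (N + 1) → Fin d → ℝ)),
      Pi.le_def (y := (1 : Fin (N + 1) → Fin d → ℝ)), Fin.forall_fin_succ', Fin.snoc_castSucc,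
      Fin.snoc_last, Pi.le_def (x := (0 : Fin N → Fin d → ℝ)),
      Pi.le_def (y := (1 : Fin N → Fin d → ℝ))]
    simp only [Pi.zero_apply, Pi.one_apply]
    tauto
  rw [hset]
  simp only [hs]
  have hcont : Continuous fun p : (Fin d → ℝ) × (Fin N → Fin d → ℝ) =>
      h (Fin.snoc (α := fun _ => Fin d → ℝ) p.2 p.1) :=
    hc.comp (Continuous.finSnoc (A := fun _ => Fin d → ℝ) continuous_snd continuous_fst)
  have hint : IntegrableOn (fun p : (Fin d → ℝ) × (Fin N → Fin d → ℝ) =>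
      h (Fin.snoc (α := fun _ => Fin d → ℝ) p.2 p.1))
      (Set.Icc (0 : Fin d → ℝ) 1 ×ˢ Set.Icc (0 : Fin N → Fin d → ℝ) 1)
      (volume.prod volume) :=
    hcont.continuousOn.integrableOn_compact (isCompact_Icc.prod isCompact_Icc)
  rw [Measure.volume_eq_prod, setIntegral_prod _ hint]
  rw [integral_integral_swap]
  rw [IntegrableOn, ← Measure.prod_restrict] at hint
  exact hint

lemma vol_one (d : ℕ) : (volume : Measure (Fin d → ℝ)).real (Set.Icc 0 1) = 1 := by
  simp [Measure.real, Real.volume_Icc_pi]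

lemma vol_one' (N d : ℕ) :
    (volume : Measure (Fin N → Fin d → ℝ)).real (Set.Icc 0 1) = 1 := by
  induction N with
  | zero =>
    have : Set.Icc (0 : Fin 0 → Fin d → ℝ) 1 = Set.univ := by
      ext y; simp [Subsingleton.elim y 0]
    rw [this]
    rw [Measure.real, volume_pi, Measure.pi_univ]
    simp
  | succ N ih =>
    have := split_last d N (fun _ => 1) continuous_const
    simpa [vol_one, ih] using this

/-- The oscillating point `(x/ε, …, x/ε^N)`. -/
noncomputable def osc (d N : ℕ) (ε : ℝ) (x : Fin d → ℝ) : Fin N → Fin d → ℝ :=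
  fun i => (ε ^ ((i : ℕ) + 1))⁻¹ • x

lemma osc_cont (d N : ℕ) (ε : ℝ) : Continuous (osc d N ε) := by
  unfold osc; fun_prop

lemma osc_succ (d N : ℕ) (ε : ℝ) (x : Fin d → ℝ) :
    osc d (N + 1) ε x = Fin.snoc (α := fun _ => Fin d → ℝ) (osc d N ε x)
      ((ε ^ (N + 1))⁻¹ • x) := by
  ext i : 1
  refine Fin.lastCases ?_ (fun i => ?_) i <;> simp [osc]

structure Good (d N : ℕ) (R : ℝ) (f : (Fin d → ℝ) → (Fin N → Fin d → ℝ) → ℝ) : Prop where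
  uc : UniformContinuous (fun p : (Fin d → ℝ) × (Fin N → Fin d → ℝ) => f p.1 p.2)
  supp : ∀ x y, R < ‖x‖ → f x y = 0
  per : ∀ (x : Fin d → ℝ) (y : Fin N → Fin d → ℝ) (i : Fin N) (k : Fin d → ℤ),
      f x (Function.update y i (y i + fun j => (k j : ℝ))) = f x y

/-- Averaging over the last variable. -/
noncomputable def avg (d N : ℕ) (f : (Fin d → ℝ) → (Fin (N + 1) → Fin d → ℝ) → ℝ) :
    (Fin d → ℝ) → (Fin N → Fin d → ℝ) → ℝ :=
  fun x y => ∫ t in Set.Icc (0 : Fin d → ℝ) 1, f x (Fin.snoc (α := fun _ => Fin d → ℝ) y t)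

lemma dist_snoc {d N : ℕ} (y y' : Fin N → Fin d → ℝ) (t t' : Fin d → ℝ) :
    dist (Fin.snoc (α := fun _ => Fin d → ℝ) y t : Fin (N + 1) → Fin d → ℝ)
      (Fin.snoc (α := fun _ => Fin d → ℝ) y' t') ≤ max (dist y y') (dist t t') := by
  refine (dist_pi_le_iff (le_max_of_le_left dist_nonneg)).2 fun i => ?_
  refine Fin.lastCases ?_ (fun i => ?_) i
  · simp
  · simp only [Fin.snoc_castSucc]
    exact le_max_of_le_left (dist_le_pi_dist y y' i)

lemma snoc_cont {d N : ℕ} {X : Type*} [TopologicalSpace X] {a : X → Fin N → Fin d → ℝ}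
    {b : X → Fin d → ℝ} (ha : Continuous a) (hb : Continuous b) :
    Continuous fun x => (Fin.snoc (α := fun _ => Fin d → ℝ) (a x) (b x) :
      Fin (N + 1) → Fin d → ℝ) :=
  Continuous.finSnoc (A := fun _ => Fin d → ℝ) ha hb

lemma Good.comp_cont {d N : ℕ} {R : ℝ} {f : (Fin d → ℝ) → (Fin N → Fin d → ℝ) → ℝ}
    (hf : Good d N R f) {X : Type*} [TopologicalSpace X] {a : X → Fin d → ℝ}
    {b : X → Fin N → Fin d → ℝ} (ha : Continuous a) (hb : Continuous b) :
    Continuous fun x => f (a x) (b x) :=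
  hf.uc.continuous.comp (ha.prodMk hb)

lemma Good.integrable {d N : ℕ} {R : ℝ} {f : (Fin d → ℝ) → (Fin N → Fin d → ℝ) → ℝ}
    (hf : Good d N R f) {b : (Fin d → ℝ) → Fin N → Fin d → ℝ} (hb : Continuous b) :
    Integrable fun x => f x (b x) := by
  refine (hf.comp_cont continuous_id hb).integrable_of_hasCompactSupport ?_
  refine HasCompactSupport.intro (isCompact_closedBall (0 : Fin d → ℝ) R) fun x hx => ?_
  exact hf.supp _ _ (by simpa using hx)

lemma Good.avg {d N : ℕ} {R : ℝ} {f : (Fin d → ℝ) → (Fin (N + 1) → Fin d → ℝ) → ℝ}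
    (hf : Good d (N + 1) R f) : Good d N R (avg d N f) := by
  refine ⟨?_, ?_, ?_⟩
  · rw [Metric.uniformContinuous_iff]
    intro δ hδ
    obtain ⟨η, hη, h⟩ := Metric.uniformContinuous_iff.1 hf.uc (δ / 2) (by positivity)
    refine ⟨η, hη, fun {p q} hpq => ?_⟩
    have hi : ∀ p : (Fin d → ℝ) × (Fin N → Fin d → ℝ), IntegrableOn
        (fun t => f p.1 (Fin.snoc (α := fun _ => Fin d → ℝ) p.2 t))
        (Set.Icc (0 : Fin d → ℝ) 1) := fun p =>
      (hf.comp_cont continuous_const (snoc_cont continuous_const continuous_id)).integrableOn_Icc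
    rw [Real.dist_eq]
    unfold _root_.avg
    rw [← integral_sub (hi p) (hi q)]
    have hb := norm_setIntegral_le_of_norm_le_const (μ := (volume : Measure (Fin d → ℝ)))
      (s := Set.Icc (0 : Fin d → ℝ) 1) (C := δ / 2)
      (f := fun t => f p.1 (Fin.snoc (α := fun _ => Fin d → ℝ) p.2 t) -
        f q.1 (Fin.snoc (α := fun _ => Fin d → ℝ) q.2 t)) isCompact_Icc.measure_lt_top ?_
    · rw [vol_one, mul_one, Real.norm_eq_abs] at hb
      linarith
    · intro t _
      have := @h (p.1, Fin.snoc (α := fun _ => Fin d → ℝ) p.2 t)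
        (q.1, Fin.snoc (α := fun _ => Fin d → ℝ) q.2 t) ?_
      · rw [Real.dist_eq] at this
        exact this.le
      · rw [Prod.dist_eq] at hpq ⊢
        have h2 := dist_snoc p.2 q.2 t t
        rw [dist_self, max_eq_left dist_nonneg] at h2
        exact max_lt (lt_of_le_of_lt (le_max_left _ _) hpq)
          (lt_of_le_of_lt (h2.trans (le_max_right _ _)) hpq)
  · intro x y hx
    simp [_root_.avg, hf.supp _ _ hx]
  · intro x y i k
    unfold _root_.avg
    congr 1
    ext t
    rw [Fin.snoc_update]
    have := hf.per x (Fin.snoc (α := fun _ => Fin d → ℝ) y t) i.castSucc k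
    rw [Fin.snoc_castSucc] at this
    exact this

lemma Good.avg_shift {d N : ℕ} {R : ℝ} {f : (Fin d → ℝ) → (Fin (N + 1) → Fin d → ℝ) → ℝ}
    (hf : Good d (N + 1) R f) (x : Fin d → ℝ) (y : Fin N → Fin d → ℝ) (a : Fin d → ℝ) :
    ∫ t in Set.Icc (0 : Fin d → ℝ) 1, f x (Fin.snoc (α := fun _ => Fin d → ℝ) y (a + t)) =
      _root_.avg d N f x y := by
  refine periodic_shift d (fun t => f x (Fin.snoc (α := fun _ => Fin d → ℝ) y t)) ?_ a
  intro t k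
  have := hf.per x (Fin.snoc (α := fun _ => Fin d → ℝ) y t) (Fin.last N) k
  rw [Fin.update_snoc_last, Fin.snoc_last] at this
  exact this

lemma step {d N : ℕ} {R : ℝ} {f : (Fin d → ℝ) → (Fin (N + 1) → Fin d → ℝ) → ℝ}
    (hf : Good d (N + 1) R f) :
    Tendsto (fun ε : ℝ => (∫ x, f x (osc d (N + 1) ε x)) - ∫ x, avg d N f x (osc d N ε x))
      (nhdsWithin 0 (Set.Ioi 0)) (nhds 0) := by
  rw [Metric.tendsto_nhds]
  intro δ hδ
  set M : ℝ := (volume : Measure (Fin d → ℝ)).real (Metric.closedBall 0 (R + 1)) with hM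
  have hM0 : 0 ≤ M := measureReal_nonneg
  set δ' : ℝ := δ / (2 * (M + 1)) with hδ'
  have hδ'0 : 0 < δ' := by positivity
  have hδM : δ' * M < δ := by
    rw [hδ', div_mul_eq_mul_div, div_lt_iff₀ (by positivity)]
    nlinarith
  obtain ⟨η, hη, h⟩ := Metric.uniformContinuous_iff.1 hf.uc δ' hδ'0
  have hev : ∀ᶠ ε : ℝ in nhdsWithin 0 (Set.Ioi 0), ε ∈ Set.Ioo 0 (min 1 η) :=
    Ioo_mem_nhdsGT (lt_min one_pos hη)
  filter_upwards [hev] with ε hε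
  obtain ⟨hε0, hε1⟩ := hε
  obtain ⟨hε1, hεη⟩ := lt_min_iff.1 hε1
  set s : ℝ := ε ^ (N + 1) with hs
  have hs0 : 0 < s := by positivity
  have hsε : s ≤ ε := by
    rw [hs, pow_succ]
    exact mul_le_of_le_one_left hε0.le (pow_le_one₀ hε0.le hε1.le)
  -- the comparison function
  set G : (Fin d → ℝ) → (Fin d → ℝ) → ℝ := fun t x =>
    f x (Fin.snoc (α := fun _ => Fin d → ℝ) (osc d N ε x) (s⁻¹ • x + t)) with hG
  have hGc : Continuous (Function.uncurry G) := by
    refine hf.comp_cont continuous_snd (snoc_cont ((osc_cont d N ε).comp continuous_snd) ?_)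
    fun_prop
  have hGi : ∀ t, Integrable (G t) := fun t =>
    hf.integrable (snoc_cont (osc_cont d N ε) (by fun_prop))
  -- pointwise estimate
  have hpt : ∀ t ∈ Set.Icc (0 : Fin d → ℝ) 1,
      |(∫ x, f x (osc d (N + 1) ε x)) - ∫ x, G t x| ≤ δ' * M := by
    intro t ht
    have htn : ‖t‖ ≤ 1 := by
      refine (pi_norm_le_iff_of_nonneg zero_le_one).2 fun i => ?_
      rw [Real.norm_eq_abs, abs_le]
      have h1 := ht.1 i
      have h2 := ht.2 i
      simp only [Pi.zero_apply, Pi.one_apply] at h1 h2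
      constructor <;> linarith
    have hst : ‖s • t‖ ≤ ε := by
      rw [norm_smul, Real.norm_eq_abs, abs_of_pos hs0]
      calc s * ‖t‖ ≤ s * 1 := by gcongr
        _ ≤ ε := by linarith
    have hF := hf.integrable (osc_cont d (N + 1) ε)
    rw [← integral_add_right_eq_self (fun x => f x (osc d (N + 1) ε x)) (s • t),
      ← integral_sub (hF.comp_add_right (s • t)) (hGi t)]
    have hzero : ∀ x ∉ Metric.closedBall (0 : Fin d → ℝ) (R + 1),
        f (x + s • t) (osc d (N + 1) ε (x + s • t)) - G t x = 0 := by
      intro x hx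
      have hx' : R + 1 < ‖x‖ := by simpa using hx
      have h1 : ‖x‖ ≤ ‖x + s • t‖ + ‖s • t‖ := by
        have := norm_sub_le (x + s • t) (s • t)
        simpa using this
      rw [hf.supp (x + s • t) _ (by linarith), hG]
      simp only
      rw [hf.supp x _ (by linarith), sub_zero]
    rw [← setIntegral_eq_integral_of_forall_compl_eq_zero hzero, ← Real.norm_eq_abs]
    refine norm_setIntegral_le_of_norm_le_const (isCompact_closedBall _ _).measure_lt_top ?_
    intro x _
    have := @h (x + s • t, osc d (N + 1) ε (x + s • t))
      (x, Fin.snoc (α := fun _ => Fin d → ℝ) (osc d N ε x) (s⁻¹ • x + t)) ?_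
    · rw [Real.dist_eq] at this
      exact this.le
    · rw [Prod.dist_eq]
      refine lt_of_le_of_lt (b := ε) (max_le ?_ ?_) hεη
      · simpa [dist_eq_norm] using hst
      · rw [osc_succ]
        refine (dist_snoc _ _ _ _).trans (max_le ?_ ?_)
        · refine (dist_pi_le_iff hε0.le).2 fun i => ?_
          rw [dist_eq_norm]
          simp only [osc]
          rw [smul_add, add_sub_cancel_left, smul_smul, norm_smul, Real.norm_eq_abs,
            abs_of_pos (by positivity)]
          have hi : (ε ^ ((i : ℕ) + 1))⁻¹ * s ≤ ε := by
            have hN : N + 1 = ((i : ℕ) + 1) + ((N - 1 - i) + 1) := by have := i.2; omega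
            rw [hs, hN, pow_add ε ((i : ℕ) + 1), inv_mul_cancel_left₀ (by positivity), pow_succ]
            exact mul_le_of_le_one_left hε0.le (pow_le_one₀ hε0.le hε1.le)
          calc _ ≤ ε * 1 := by gcongr
            _ = ε := mul_one _
        · rw [← hs, smul_add, smul_smul, inv_mul_cancel₀ hs0.ne', one_smul, dist_self]
          exact hε0.le
  -- averaging in t
  have hGint : Integrable (Function.uncurry G)
      ((volume.restrict (Set.Icc (0 : Fin d → ℝ) 1)).prod (volume : Measure (Fin d → ℝ))) := by
    have h1 : IntegrableOn (Function.uncurry G)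
        (Set.Icc (0 : Fin d → ℝ) 1 ×ˢ Metric.closedBall (0 : Fin d → ℝ) R)
        (volume.prod volume) :=
      hGc.continuousOn.integrableOn_compact (isCompact_Icc.prod (isCompact_closedBall _ _))
    have h2 : IntegrableOn (Function.uncurry G)
        (Set.Icc (0 : Fin d → ℝ) 1 ×ˢ (Set.univ : Set (Fin d → ℝ)))
        (volume.prod volume) := by
      refine h1.of_forall_sdiff_eq_zero (measurableSet_Icc.prod MeasurableSet.univ) ?_
      rintro ⟨t, x⟩ ⟨hx1, hx2⟩
      have : R < ‖x‖ := by
        by_contra hcon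
        exact hx2 ⟨hx1.1, by simpa using hcon⟩
      exact hf.supp x _ this
    rw [IntegrableOn, ← Measure.prod_restrict, Measure.restrict_univ] at h2
    exact h2
  have hswap := integral_integral_swap hGint
  have havg : ∫ x, avg d N f x (osc d N ε x) =
      ∫ t in Set.Icc (0 : Fin d → ℝ) 1, ∫ x, G t x := by
    rw [hswap]
    congr 1
    ext x
    exact (hf.avg_shift x (osc d N ε x) (s⁻¹ • x)).symm
  have hconst : (∫ x, f x (osc d (N + 1) ε x)) =
      ∫ t in Set.Icc (0 : Fin d → ℝ) 1, ∫ x, f x (osc d (N + 1) ε x) := by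
    rw [setIntegral_const, vol_one, one_smul]
  have hci : IntegrableOn (fun _ : Fin d → ℝ => ∫ x, f x (osc d (N + 1) ε x))
      (Set.Icc (0 : Fin d → ℝ) 1) := continuous_const.integrableOn_Icc
  have hGl : Integrable (fun t => ∫ x, G t x) (volume.restrict (Set.Icc (0 : Fin d → ℝ) 1)) :=
    hGint.integral_prod_left
  rw [havg, hconst, ← integral_sub hci hGl, dist_zero_right]
  have := norm_setIntegral_le_of_norm_le_const (μ := (volume : Measure (Fin d → ℝ)))
    (f := fun t => (∫ x, f x (osc d (N + 1) ε x)) - ∫ x, G t x)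
    isCompact_Icc.measure_lt_top hpt
  rw [vol_one, mul_one] at this
  exact lt_of_le_of_lt this hδM

lemma good_tendsto (d N : ℕ) (R : ℝ) (f : (Fin d → ℝ) → (Fin N → Fin d → ℝ) → ℝ)
    (hf : Good d N R f) :
    Tendsto (fun ε : ℝ => ∫ x, f x (osc d N ε x)) (nhdsWithin 0 (Set.Ioi 0))
      (nhds (∫ x, ∫ y in Set.Icc (0 : Fin N → Fin d → ℝ) 1, f x y)) := by
  induction N with
  | zero =>
    have h1 : ∀ x, ∫ y in Set.Icc (0 : Fin 0 → Fin d → ℝ) 1, f x y = f x 0 := by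
      intro x
      have : ∀ y, f x y = f x 0 := fun y => by rw [Subsingleton.elim y 0]
      simp_rw [this]
      rw [setIntegral_const, vol_one', one_smul]
    have h2 : ∀ ε x, osc d 0 ε x = 0 := fun ε x => Subsingleton.elim _ _
    simp_rw [h1, h2]
    exact tendsto_const_nhds
  | succ N ih =>
    have h1 := (step hf).add (ih _ hf.avg)
    simp only [sub_add_cancel, zero_add] at h1
    have h2 : ∀ x, ∫ y in Set.Icc (0 : Fin (N + 1) → Fin d → ℝ) 1, f x y =
        ∫ y in Set.Icc (0 : Fin N → Fin d → ℝ) 1, avg d N f x y := fun x =>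
      split_last d N (f x) (hf.comp_cont continuous_const continuous_id)
    simp_rw [h2]
    exact h1

/-- General `L¹` weight. -/
lemma weighted_tendsto (d N : ℕ) (ρ : (Fin d → ℝ) → ℝ) (hρ : Integrable ρ)
    (g : (Fin d → ℝ) → (Fin N → Fin d → ℝ) → ℝ) (C : ℝ) (hC : ∀ x y, |g x y| ≤ C)
    (hg : UniformContinuous (fun p : (Fin d → ℝ) × (Fin N → Fin d → ℝ) => g p.1 p.2))
    (hper : ∀ (x : Fin d → ℝ) (y : Fin N → Fin d → ℝ) (i : Fin N) (k : Fin d → ℤ),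
      g x (Function.update y i (y i + fun j => (k j : ℝ))) = g x y) :
    Tendsto (fun ε : ℝ => ∫ x, ρ x * g x (osc d N ε x)) (nhdsWithin 0 (Set.Ioi 0))
      (nhds (∫ x, ∫ y in Set.Icc (0 : Fin N → Fin d → ℝ) 1, ρ x * g x y)) := by
  have hC0 : 0 ≤ C := (abs_nonneg _).trans (hC 0 0)
  have hgc := hg.continuous
  set gb : (Fin d → ℝ) → ℝ := fun x => ∫ y in Set.Icc (0 : Fin N → Fin d → ℝ) 1, g x y with hgb
  have hgbc : Continuous gb :=
    continuous_parametric_integral_of_continuous (f := g) hgc isCompact_Icc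
  have hgbC : ∀ x, |gb x| ≤ C := by
    intro x
    have := norm_setIntegral_le_of_norm_le_const
      (μ := (volume : Measure (Fin N → Fin d → ℝ))) (s := Set.Icc 0 1) (f := g x) (C := C)
      isCompact_Icc.measure_lt_top (fun y _ => hC x y)
    rwa [vol_one', mul_one] at this
  -- general estimate
  have est : ∀ (ρ' : (Fin d → ℝ) → ℝ), Integrable ρ' → ∀ k : (Fin d → ℝ) → ℝ, Continuous k →
      (∀ x, |k x| ≤ C) → |(∫ x, ρ x * k x) - ∫ x, ρ' x * k x| ≤ C * ∫ x, ‖ρ x - ρ' x‖ := by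
    intro ρ' hρ' k hk hkC
    have i1 : Integrable fun x => ρ x * k x :=
      hρ.mul_bdd (c := C) hk.aestronglyMeasurable (Eventually.of_forall hkC)
    have i2 : Integrable fun x => ρ' x * k x :=
      hρ'.mul_bdd (c := C) hk.aestronglyMeasurable (Eventually.of_forall hkC)
    rw [← integral_sub i1 i2, ← integral_const_mul, ← Real.norm_eq_abs]
    refine norm_integral_le_of_norm_le ((hρ.sub hρ').norm.const_mul C)
      (Eventually.of_forall fun x => ?_)
    rw [← sub_mul, norm_mul, mul_comm]
    exact mul_le_mul_of_nonneg_right (hkC x) (norm_nonneg _)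
  simp_rw [integral_const_mul]
  rw [Metric.tendsto_nhds]
  intro δ hδ
  obtain ⟨ρ', hρ'c, hρ'e, hρ'k, hρ'i⟩ :=
    hρ.exists_hasCompactSupport_integral_sub_le (ε := δ / (4 * (C + 1))) (by positivity)
  have hsmall : C * ∫ x, ‖ρ x - ρ' x‖ ≤ δ / 4 := by
    calc C * ∫ x, ‖ρ x - ρ' x‖ ≤ C * (δ / (4 * (C + 1))) := by gcongr
      _ ≤ δ / 4 := by
        rw [mul_div_assoc', div_le_div_iff₀ (by positivity) (by positivity)]
        nlinarith
  obtain ⟨R, hR⟩ := hρ'c.isCompact.isBounded.subset_closedBall (0 : Fin d → ℝ)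
  obtain ⟨B, hB⟩ := hρ'k.bounded_above_of_compact_support hρ'c
  have hgood : Good d N R (fun x y => ρ' x * g x y) := by
    refine ⟨?_, ?_, ?_⟩
    · have hu : UniformContinuous ρ' := hρ'c.uniformContinuous_of_continuous hρ'k
      rw [Metric.uniformContinuous_iff] at hu hg ⊢
      intro e he
      have hB0 : 0 ≤ B := (norm_nonneg _).trans (hB 0)
      obtain ⟨η1, hη1, h1⟩ := hu (e / (2 * (C + 1))) (by positivity)
      obtain ⟨η2, hη2, h2⟩ := hg (e / (2 * (B + 1))) (by positivity)
      refine ⟨min η1 η2, lt_min hη1 hη2, fun {p q} hpq => ?_⟩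
      have a1 := @h1 p.1 q.1 (lt_of_le_of_lt (by rw [Prod.dist_eq]; exact le_max_left _ _)
        (lt_of_lt_of_le hpq (min_le_left _ _)))
      have a2 := @h2 p q (lt_of_lt_of_le hpq (min_le_right _ _))
      rw [Real.dist_eq] at a1 a2 ⊢
      have e1 : ρ' p.1 * g p.1 p.2 - ρ' q.1 * g q.1 q.2 =
        (ρ' p.1 - ρ' q.1) * g p.1 p.2 + ρ' q.1 * (g p.1 p.2 - g q.1 q.2) := by ring
      rw [e1]
      refine (abs_add_le _ _).trans_lt ?_
      rw [abs_mul, abs_mul]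
      have b1 : |ρ' p.1 - ρ' q.1| * |g p.1 p.2| ≤ e / (2 * (C + 1)) * C := by
        gcongr
        exact hC _ _
      have b2 : |ρ' q.1| * |g p.1 p.2 - g q.1 q.2| ≤ B * (e / (2 * (B + 1))) := by
        gcongr
        exact hB _
      have b3 : e / (2 * (C + 1)) * C < e / 2 := by
        rw [div_mul_eq_mul_div, div_lt_div_iff₀ (by positivity) (by positivity)]
        nlinarith
      have b4 : B * (e / (2 * (B + 1))) < e / 2 := by
        rw [mul_div_assoc', div_lt_div_iff₀ (by positivity) (by positivity)]
        nlinarith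
      linarith
    · intro x y hx
      have : ρ' x = 0 := by
        by_contra hne
        have := hR (subset_tsupport _ hne)
        simp at this
        linarith
      simp [this]
    · intro x y i k
      simp only [hper]
  have ht := good_tendsto d N R _ hgood
  simp_rw [integral_const_mul] at ht
  rw [Metric.tendsto_nhds] at ht
  filter_upwards [ht (δ / 4) (by positivity)] with ε hε
  have c1 := est ρ' hρ'i (fun x => g x (osc d N ε x))
    (hgc.comp (continuous_id.prodMk (osc_cont d N ε))) (fun x => hC _ _)
  have c2 := est ρ' hρ'i gb hgbc hgbC
  rw [Real.dist_eq] at hε ⊢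
  rw [abs_lt] at hε ⊢
  rw [abs_le] at c1 c2
  simp only [hgb] at c2
  constructor <;> linarith [c1.1, c1.2, c2.1, c2.2, hε.1, hε.2]

end helpers

/-- Convergence of the partition functions:
`∫_{ℝ^d} e^{-V(x,x/ε,…,x/ε^N)/σ} dx → ∫_{ℝ^d} ∫_{([0,1]^d)^N} e^{-V(x,y₁,…,y_N)/σ} dy dx`
as `ε → 0⁺`. -/
theorem stmt7 (d N : ℕ) (hd : 1 ≤ d) (hN : 1 ≤ N) (σ : ℝ) (hσ : 0 < σ)
    (V₀ : (Fin d → ℝ) → ℝ) (hV₀smooth : ContDiff ℝ (⊤ : ℕ∞) V₀)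
    (hV₀int : Integrable (fun x => Real.exp (-V₀ x / σ)))
    (hV₀conf : Tendsto V₀ (cocompact (Fin d → ℝ)) atTop)
    (V₁ : (Fin d → ℝ) → (Fin N → Fin d → ℝ) → ℝ)
    (hV₁smooth : ContDiff ℝ (⊤ : ℕ∞) (fun p : (Fin d → ℝ) × (Fin N → Fin d → ℝ) => V₁ p.1 p.2))
    (hV₁der : ∀ n : ℕ, ∃ C : ℝ, ∀ p : (Fin d → ℝ) × (Fin N → Fin d → ℝ),
      ‖iteratedFDeriv ℝ n (fun q : (Fin d → ℝ) × (Fin N → Fin d → ℝ) => V₁ q.1 q.2) p‖ ≤ C)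
    (hV₁bdd : ∃ C : ℝ, ∀ x y, |V₁ x y| ≤ C)
    (hV₁per : ∀ (x : Fin d → ℝ) (y : Fin N → Fin d → ℝ) (i : Fin N) (k : Fin d → ℤ),
      V₁ x (Function.update y i (y i + fun j => (k j : ℝ))) = V₁ x y) :
    Tendsto
      (fun ε : ℝ => ∫ x, Real.exp (-(V₀ x + V₁ x fun i => (ε ^ ((i : ℕ) + 1))⁻¹ • x) / σ))
      (nhdsWithin 0 (Set.Ioi 0))
      (nhds (∫ x, ∫ y in Set.Icc (0 : Fin N → Fin d → ℝ) 1,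
        Real.exp (-(V₀ x + V₁ x y) / σ))) := by
  obtain ⟨C, hC⟩ := hV₁bdd
  obtain ⟨L, hL⟩ := hV₁der 1
  have hlip : UniformContinuous
      (fun p : (Fin d → ℝ) × (Fin N → Fin d → ℝ) => V₁ p.1 p.2) := by
    have hl : LipschitzWith (Real.toNNReal L)
        (fun p : (Fin d → ℝ) × (Fin N → Fin d → ℝ) => V₁ p.1 p.2) := by
      refine lipschitzWith_of_nnnorm_fderiv_le (𝕜 := ℝ)
        (hV₁smooth.differentiable (by simp)) fun p => ?_
      have := hL p
      rw [norm_iteratedFDeriv_one] at this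
      exact NNReal.coe_le_coe.1 (this.trans (Real.le_coe_toNNReal L))
    exact hl.uniformContinuous
  have hexp : UniformContinuousOn (fun z : ℝ => Real.exp (-z / σ)) (Set.Icc (-C) C) :=
    isCompact_Icc.uniformContinuousOn_of_continuous (by fun_prop)
  have hguc : UniformContinuous
      (fun p : (Fin d → ℝ) × (Fin N → Fin d → ℝ) => Real.exp (-V₁ p.1 p.2 / σ)) := by
    rw [← uniformContinuousOn_univ] at hlip ⊢
    exact hexp.comp hlip (fun p _ => abs_le.1 (hC p.1 p.2))
  have key := weighted_tendsto d N (fun x => Real.exp (-V₀ x / σ)) hV₀int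
    (fun x y => Real.exp (-V₁ x y / σ)) (Real.exp (C / σ)) (fun x y => by
      rw [abs_of_pos (Real.exp_pos _), Real.exp_le_exp]
      have := (abs_le.1 (hC x y)).1
      gcongr
      linarith) hguc (fun x y i k => by simp only [hV₁per])
  have hsplit : ∀ x y, Real.exp (-(V₀ x + V₁ x y) / σ) =
      Real.exp (-V₀ x / σ) * Real.exp (-V₁ x y / σ) := by
    intro x y
    rw [← Real.exp_add]
    congr 1
    ring
  simp only [hsplit]
  exact key
end

section
/- Let σ > 0 and α > 0. For ε > 0 let π^ε be the probability density on ℝ proportional to e^{-(x²/2 + α sin(2πx/ε))/σ}, and let π⁰(x) = (2πσ)^{-1/2} e^{-x²/(2σ)}. Define the relative entropy H(π^ε | π⁰) = ∫_ℝ π^ε(x) log(π^ε(x)/π⁰(x)) dx, and set A = ∫_0^1 e^{-(α/σ) sin(2πy)} dy and B = ∫_0^1 sin(2πy) e^{-(α/σ) sin(2πy)} dy. Then lim_{ε → 0⁺} H(π^ε | π⁰) = −log A − (α/σ)·(B/A), and this limit is strictly positive. -/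
open MeasureTheory Filter Real

theorem periodic_bound (g : ℝ → ℝ) (hg : Continuous g) (hp : Function.Periodic g 1) :
    ∃ C, ∀ x, ‖g x‖ ≤ C := by
  obtain ⟨C, hC⟩ := (hp.isBounded_of_continuous one_ne_zero hg).exists_norm_le
  exact ⟨C, fun x => hC _ ⟨x, rfl⟩⟩

theorem osc_integrable (b : ℝ) (hb : 0 < b) (g : ℝ → ℝ) (hg : Continuous g)
    (hp : Function.Periodic g 1) (ε : ℝ) :
    Integrable (fun x => Real.exp (-b * x ^ 2) * g (x / ε)) := by
  obtain ⟨C, hC⟩ := periodic_bound g hg hp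
  exact (integrable_exp_neg_mul_sq hb).mul_bdd (c := C)
    (by fun_prop) (Eventually.of_forall fun x => hC _)

/-- Averaging of rapidly oscillating periodic functions of zero mean. -/
theorem osc_zero (b : ℝ) (hb : 0 < b) (g : ℝ → ℝ) (hg : Continuous g)
    (hp : Function.Periodic g 1) (hm : ∫ y in (0:ℝ)..1, g y = 0) :
    Tendsto (fun ε : ℝ => ∫ x, Real.exp (-b * x ^ 2) * g (x / ε))
      (nhdsWithin 0 (Set.Ioi 0)) (nhds 0) := by
  set G : ℝ → ℝ := fun t => ∫ y in (0:ℝ)..t, g y with hG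
  have hGd : ∀ t, HasDerivAt G (g t) t := fun t => hg.integral_hasStrictDerivAt 0 t |>.hasDerivAt
  have hGc : Continuous G := continuous_iff_continuousAt.2 fun t => (hGd t).continuousAt
  have hGp : Function.Periodic G 1 := by
    intro t
    have h1 := hp.intervalIntegral_add_eq_add 0 t (fun a b => hg.intervalIntegrable a b)
    simp only [zero_add, hm, add_zero] at h1
    exact h1
  obtain ⟨C, hC⟩ := periodic_bound G hGc hGp
  set D := ∫ x : ℝ, C * ‖(2 * b) * (x * Real.exp (-b * x ^ 2))‖ with hD
  have hi0 : Integrable (fun x : ℝ => (2 * b) * (x * Real.exp (-b * x ^ 2))) :=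
    (integrable_mul_exp_neg_mul_sq hb).const_mul _
  have hi1 : Integrable (fun x : ℝ => C * ‖(2 * b) * (x * Real.exp (-b * x ^ 2))‖) :=
    hi0.norm.const_mul _
  have key : ∀ ε : ℝ, 0 < ε → ‖∫ x, Real.exp (-b * x ^ 2) * g (x / ε)‖ ≤ ε * D := by
    intro ε hε
    have hu : ∀ x : ℝ, HasDerivAt (fun x : ℝ => Real.exp (-b * x ^ 2))
        (-((2 * b) * (x * Real.exp (-b * x ^ 2)))) x := by
      intro x
      have := ((hasDerivAt_pow 2 x).const_mul (-b)).exp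
      convert this using 1
      push_cast
      ring
    have hv : ∀ x : ℝ, HasDerivAt (fun x : ℝ => ε * G (x / ε)) (g (x / ε)) x := by
      intro x
      have := ((hGd (x / ε)).comp x ((hasDerivAt_id x).div_const ε)).const_mul ε
      have e : ε * (g (x / ε) * (1 / ε)) = g (x / ε) := by field_simp
      rw [e] at this
      exact this
    have hint1 : Integrable ((fun x : ℝ => -((2 * b) * (x * Real.exp (-b * x ^ 2)))) *
        fun x : ℝ => ε * G (x / ε)) := by
      have := (hi0.neg.mul_bdd (c := C) (g := fun x => G (x / ε)) (by fun_prop)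
        (Eventually.of_forall fun x => hC _)).const_mul ε
      refine this.congr (Eventually.of_forall fun x => ?_)
      simp only [Pi.mul_apply, Pi.neg_apply]
      ring
    have hint2 : Integrable ((fun x : ℝ => Real.exp (-b * x ^ 2)) *
        fun x : ℝ => ε * G (x / ε)) := by
      refine ((osc_integrable b hb G hGc hGp ε).const_mul ε).congr
        (Eventually.of_forall fun x => ?_)
      simp only [Pi.mul_apply]
      ring
    have ibp := integral_mul_deriv_eq_deriv_mul_of_integrable
      (u := fun x : ℝ => Real.exp (-b * x ^ 2)) (v := fun x : ℝ => ε * G (x / ε))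
      (fun x _ => hu x) (fun x _ => hv x) (osc_integrable b hb g hg hp ε) hint1 hint2
    rw [ibp, norm_neg, hD, ← integral_const_mul]
    refine norm_integral_le_of_norm_le (hi1.const_mul ε) (Eventually.of_forall fun x => ?_)
    rw [norm_mul, norm_mul ε, norm_neg, Real.norm_of_nonneg hε.le]
    have := mul_le_mul_of_nonneg_left (hC (x / ε))
      (mul_nonneg hε.le (norm_nonneg ((2 * b) * (x * Real.exp (-b * x ^ 2)))))
    linarith
  refine squeeze_zero_norm' (a := fun ε => ε * D) ?_ ?_
  · filter_upwards [self_mem_nhdsWithin] with ε hε using key ε hε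
  · have : Tendsto (fun ε : ℝ => ε * D) (nhds 0) (nhds (0 * D)) := tendsto_id.mul_const D
    rw [zero_mul] at this
    exact this.mono_left nhdsWithin_le_nhds

theorem osc_lim (b : ℝ) (hb : 0 < b) (g : ℝ → ℝ) (hg : Continuous g)
    (hp : Function.Periodic g 1) :
    Tendsto (fun ε : ℝ => ∫ x, Real.exp (-b * x ^ 2) * g (x / ε))
      (nhdsWithin 0 (Set.Ioi 0)) (nhds ((∫ y in (0:ℝ)..1, g y) * √(π / b))) := by
  set m := ∫ y in (0:ℝ)..1, g y with hm
  have h0 := osc_zero b hb (fun y => g y - m) (by fun_prop) (fun y => by simp [hp y]) (by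
    rw [intervalIntegral.integral_sub (hg.intervalIntegrable _ _) (by simp)]
    simp [hm])
  have h1 := h0.add_const (m * √(π / b))
  rw [zero_add] at h1
  refine h1.congr fun ε => ?_
  rw [← integral_gaussian b, ← integral_const_mul, ← integral_add]
  · congr 1
    ext x
    ring
  · exact osc_integrable b hb (fun y => g y - m) (by fun_prop) (fun y => by simp [hp y]) ε
  · exact (integrable_exp_neg_mul_sq hb).const_mul _

/-- Relative entropy of `π^ε ∝ e^{-(x²/2 + α sin(2πx/ε))/σ}` with respect
to the Gaussian `π⁰ = N(0,σ)` converges, as `ε → 0⁺`, to `-log A - (α/σ)(B/A)` with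
`A = ∫_0^1 e^{-(α/σ) sin(2πy)} dy`, `B = ∫_0^1 sin(2πy) e^{-(α/σ) sin(2πy)} dy`, and this
limit is strictly positive. -/
theorem stmt12 (σ α : ℝ) (hσ : 0 < σ) (hα : 0 < α)
    (πeps : ℝ → ℝ → ℝ)
    (hπeps : ∀ ε x, πeps ε x =
      Real.exp (-(x ^ 2 / 2 + α * Real.sin (2 * π * x / ε)) / σ) /
        ∫ z, Real.exp (-(z ^ 2 / 2 + α * Real.sin (2 * π * z / ε)) / σ))
    (π0 : ℝ → ℝ)
    (hπ0 : ∀ x, π0 x = (Real.sqrt (2 * π * σ))⁻¹ * Real.exp (-x ^ 2 / (2 * σ)))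
    (A B : ℝ)
    (hA : A = ∫ y in (0:ℝ)..1, Real.exp (-(α / σ) * Real.sin (2 * π * y)))
    (hB : B = ∫ y in (0:ℝ)..1, Real.sin (2 * π * y) * Real.exp (-(α / σ) * Real.sin (2 * π * y))) :
    Tendsto (fun ε : ℝ => ∫ x, πeps ε x * Real.log (πeps ε x / π0 x))
      (nhdsWithin 0 (Set.Ioi 0)) (nhds (-Real.log A - (α / σ) * (B / A))) ∧
    0 < -Real.log A - (α / σ) * (B / A) := by
  set c := α / σ with hc
  have hcpos : 0 < c := div_pos hα hσ
  set g : ℝ → ℝ := fun y => Real.exp (-c * Real.sin (2 * π * y)) with hg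
  set h : ℝ → ℝ := fun y => Real.sin (2 * π * y) * Real.exp (-c * Real.sin (2 * π * y)) with hh
  have hgc : Continuous g := by fun_prop
  have hhc : Continuous h := by fun_prop
  have hsp : ∀ y : ℝ, Real.sin (2 * π * (y + 1)) = Real.sin (2 * π * y) := by
    intro y
    rw [mul_add, mul_one, Real.sin_add_two_pi]
  have hgp : Function.Periodic g 1 := fun y => by simp only [hg, hsp]
  have hhp : Function.Periodic h 1 := fun y => by simp only [hh, hsp]
  have hgpos : ∀ y, 0 < g y := fun y => Real.exp_pos _
  have hApos : 0 < A := by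
    rw [hA]
    exact intervalIntegral.intervalIntegral_pos_of_pos (hgc.intervalIntegrable _ _) hgpos one_pos
  have hb : 0 < 1 / (2 * σ) := by positivity
  set b := 1 / (2 * σ) with hbdef
  have hsq : √(π / b) = √(2 * π * σ) := by
    congr 1
    rw [hbdef]
    field_simp
  have hSpos : 0 < √(2 * π * σ) := Real.sqrt_pos.2 (by positivity)
  set S := √(2 * π * σ) with hS
  have hlimZ := osc_lim b hb g hgc hgp
  have hlimN := osc_lim b hb h hhc hhp
  rw [hsq, ← hA] at hlimZ
  rw [hsq, ← hB] at hlimN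
  set Z : ℝ → ℝ := fun ε => ∫ x, Real.exp (-b * x ^ 2) * g (x / ε) with hZ
  set N : ℝ → ℝ := fun ε => ∫ x, Real.exp (-b * x ^ 2) * h (x / ε) with hN
  have hf : ∀ ε x : ℝ, Real.exp (-(x ^ 2 / 2 + α * Real.sin (2 * π * x / ε)) / σ) =
      Real.exp (-b * x ^ 2) * g (x / ε) := by
    intro ε x
    simp only [hg]
    rw [← Real.exp_add, hbdef, hc, mul_div_assoc (2 * π) x ε]
    congr 1
    field_simp
    ring
  have hπ : ∀ ε x, πeps ε x = Real.exp (-b * x ^ 2) * g (x / ε) / Z ε := by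
    intro ε x
    rw [hπeps, hf]
    simp only [hf, hZ]
  have hπ0' : ∀ x, π0 x = S⁻¹ * Real.exp (-b * x ^ 2) := by
    intro x
    rw [hπ0]
    congr 2
    rw [hbdef]
    field_simp
  constructor
  · have hlim : Tendsto (fun ε => Real.log (S / Z ε) - c * (N ε / Z ε))
        (nhdsWithin 0 (Set.Ioi 0)) (nhds (-Real.log A - c * (B / A))) := by
      have hAS : A * S ≠ 0 := by positivity
      have h1 : Tendsto (fun ε => S / Z ε) (nhdsWithin 0 (Set.Ioi 0)) (nhds (S / (A * S))) :=
        tendsto_const_nhds.div hlimZ hAS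
      have h2 := h1.log (by positivity)
      have h3 := (hlimN.div hlimZ hAS).const_mul c
      have h4 := h2.sub h3
      have e1 : Real.log (S / (A * S)) = -Real.log A := by
        rw [← Real.log_inv]
        congr 1
        field_simp
      have e2 : B * S / (A * S) = B / A := by field_simp
      rw [e1, e2] at h4
      exact h4
    refine hlim.congr' ?_
    have hZev : ∀ᶠ ε in nhdsWithin 0 (Set.Ioi 0), 0 < Z ε :=
      hlimZ.eventually (lt_mem_nhds (by positivity))
    filter_upwards [hZev] with ε hZε
    have hpt : ∀ x, πeps ε x * Real.log (πeps ε x / π0 x) =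
        (Real.log (S / Z ε) / Z ε) * (Real.exp (-b * x ^ 2) * g (x / ε)) -
          (c / Z ε) * (Real.exp (-b * x ^ 2) * h (x / ε)) := by
      intro x
      have e : πeps ε x / π0 x = (S / Z ε) * g (x / ε) := by
        rw [hπ, hπ0']
        field_simp
      rw [e, Real.log_mul (by positivity) (hgpos _).ne', hπ]
      simp only [hg, hh, Real.log_exp]
      field_simp
      ring
    simp only [hpt]
    rw [integral_sub ((osc_integrable b hb g hgc hgp ε).const_mul _)
      ((osc_integrable b hb h hhc hhp ε).const_mul _), integral_const_mul, integral_const_mul]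
    change _ = Real.log (S / Z ε) / Z ε * Z ε - c / Z ε * N ε
    field_simp
  · set w : ℝ → ℝ := fun y => -c * Real.sin (2 * π * y) - Real.log A with hw
    have hgw : ∀ y, g y = A * Real.exp (w y) := by
      intro y
      simp only [hg, hw]
      rw [Real.exp_sub, Real.exp_log hApos]
      field_simp
    set φ : ℝ → ℝ := fun y => g y * w y - g y + A with hφ
    have hwc : Continuous w := by fun_prop
    have hφc : Continuous φ := by fun_prop
    have hφe : ∀ y, φ y = g y * (w y - 1 + Real.exp (-w y)) := by
      intro y
      simp only [hφ]
      have : g y * Real.exp (-w y) = A := by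
        rw [hgw, mul_assoc, ← Real.exp_add]
        simp
      rw [mul_add, this]
      ring
    have hφnn : ∀ y, 0 ≤ φ y := by
      intro y
      rw [hφe]
      exact mul_nonneg (hgpos y).le (by linarith [Real.add_one_le_exp (-w y)])
    have hφpos : ∀ y, w y ≠ 0 → 0 < φ y := by
      intro y hy
      rw [hφe]
      exact mul_pos (hgpos y) (by linarith [Real.add_one_lt_exp (neg_ne_zero.2 hy)])
    have hint : ∫ y in (0:ℝ)..1, φ y = A * (-Real.log A - c * (B / A)) := by
      have e : ∀ y, φ y = (-c) * h y + (-(Real.log A + 1)) * g y + A := by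
        intro y
        simp only [hφ, hw, hh, hg]
        ring
      simp only [e]
      rw [intervalIntegral.integral_add (Continuous.intervalIntegrable (by fun_prop) _ _) (by simp),
        intervalIntegral.integral_add (Continuous.intervalIntegrable (by fun_prop) _ _)
          (Continuous.intervalIntegrable (by fun_prop) _ _),
        intervalIntegral.integral_const_mul, intervalIntegral.integral_const_mul, ← hA, ← hB]
      simp only [intervalIntegral.integral_const, sub_zero, one_smul]
      field_simp
      ring
    have hex : ∃ y ∈ Set.Icc (0:ℝ) 1, 0 < φ y := by
      by_cases h0 : w 0 = 0
      · refine ⟨1 / 4, by norm_num, hφpos _ ?_⟩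
        have e0 : Real.log A = 0 := by simpa [hw] using h0
        have e1 : 2 * π * (1 / 4) = π / 2 := by ring
        simp only [hw]
        rw [e0, e1, Real.sin_pi_div_two]
        linarith
      · exact ⟨0, by norm_num, hφpos _ h0⟩
    have hpos : 0 < ∫ y in (0:ℝ)..1, φ y :=
      intervalIntegral.integral_pos one_pos hφc.continuousOn (fun y _ => hφnn y) hex
    rw [hint] at hpos
    exact (mul_pos_iff_of_pos_left hApos).1 hpos
end
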